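/- arXiv:math/0607139 — 2 statements merged into one kernel-verified Lean document; each statement's English description precedes it below -/
import Mathlib

section
/- Let 𝒜 be an abelian category, ℋ a hereditary abelian category, and F : D^b(𝒜) → D^b(ℋ) a triangulated equivalence; for each indecomposable Q of 𝒜 write F(Q[0]) ≅ f(Q)[n(Q)]. Then |n(Q) − n(Q')| ≤ d(Q, Q') for any two indecomposables Q, Q' of 𝒜, where d(Q,Q') is the distance between Q and Q' in the undirected graph underlying G(𝒜). Consequently, if 𝒜 is of finite length and the diameter d = sup_{Q,Q'} d(Q,Q') of this graph is finite, then gldim 𝒜 ≤ d + 1 and projd_𝒜 Q + injd_𝒜 Q ≤ d + 2 for every indecomposable Q. -/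
/-!
Statement 9: `|n(Q) − n(Q')| ≤ d(Q,Q')` where `d` is the distance in the
undirected graph underlying `G(𝒜)`; consequently, if `𝒜` has finite length
and the diameter `d` of this graph is finite, then `gldim 𝒜 ≤ d + 1` and
`projd Q + injd Q ≤ d + 2` for every indecomposable `Q`.
-/

open CategoryTheory CategoryTheory.Limits

universe w w' v u v' u'

namespace PiecewiseHereditaryPaper

variable (𝒜 : Type u) [Category.{v} 𝒜] [Abelian 𝒜] [HasDerivedCategory.{w} 𝒜]

/-- `Ext^d(X,Y) ≠ 0`, where `Ext^d` is computed as `Hom_{D(𝒜)}(X[0], Y[0][d])`. -/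
def extNonzero (X Y : 𝒜) (d : ℤ) : Prop :=
  ∃ g : (DerivedCategory.singleFunctor 𝒜 0).obj X ⟶
      (((DerivedCategory.singleFunctor 𝒜 0).obj Y)⟦d⟧), g ≠ 0

/-- An abelian category is hereditary if `Ext^d` vanishes for all `d ≥ 2`. -/
def Hereditary : Prop := ∀ (X Y : 𝒜) (d : ℕ), 2 ≤ d → ¬ extNonzero 𝒜 X Y (d : ℤ)

variable (ℋ : Type u') [Category.{v'} ℋ] [Abelian ℋ] [HasDerivedCategory.{w'} ℋ]

/-- The projective dimension `projd_𝒜 Q`. -/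
noncomputable def projDim (Q : 𝒜) : ℕ∞ :=
  ⨆ (d : ℕ) (_ : ∃ Q' : 𝒜, extNonzero 𝒜 Q Q' d), (d : ℕ∞)

/-- The injective dimension `injd_𝒜 Q`. -/
noncomputable def injDim (Q : 𝒜) : ℕ∞ :=
  ⨆ (d : ℕ) (_ : ∃ Q' : 𝒜, extNonzero 𝒜 Q' Q d), (d : ℕ∞)

/-- The global dimension `gldim 𝒜 = sup_Q projd_𝒜 Q`. -/
noncomputable def gldim : ℕ∞ := ⨆ Q : 𝒜, projDim 𝒜 Q

/-- Finite length: every object has a finite composition series. -/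
def FiniteLength : Prop :=
  ∀ X : 𝒜, ∃ (m : ℕ) (f : Fin (m + 1) → Subobject X),
    f 0 = ⊥ ∧ f (Fin.last m) = ⊤ ∧ ∀ i : Fin m, f i.castSucc ⋖ f i.succ

/-- An undirected path of length `m` between indecomposables in the graph
`G̃(𝒜)` obtained from `G(𝒜)` by forgetting the directions of the edges. -/
def UndirPath (m : ℕ) (Q Q' : 𝒜) : Prop :=
  ∃ c : Fin (m + 1) → 𝒜,
    c 0 = Q ∧ c (Fin.last m) = Q' ∧ (∀ i, Indecomposable (c i)) ∧
    ∀ i : Fin m,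
      (∃ g : c i.castSucc ⟶ c i.succ, g ≠ 0) ∨ (∃ g : c i.succ ⟶ c i.castSucc, g ≠ 0)

/-- The distance between two indecomposables in `G̃(𝒜)`: the length of the
shortest path between them, or `+∞` if there is no such path. -/
noncomputable def gdist (Q Q' : 𝒜) : ℕ∞ :=
  ⨅ (m : ℕ) (_ : UndirPath 𝒜 m Q Q'), (m : ℕ∞)

/-- The diameter of `G̃(𝒜)`: the sup of the distances between indecomposables. -/
noncomputable def diam : ℕ∞ :=
  ⨆ (Q : 𝒜) (Q' : 𝒜) (_ : Indecomposable Q) (_ : Indecomposable Q'), gdist 𝒜 Q Q'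

section Helpers

variable {C : Type u} [Category.{v} C] [Abelian C]

/-- The modular law in the lattice of subobjects of an object of an abelian category. -/
lemma mod_aux {X : C} (a b c : Subobject X) (hac : a ≤ c) :
    (a ⊔ b) ⊓ c ≤ a ⊔ (b ⊓ c) := by
  let φ := biprod.desc a.arrow b.arrow
  let s := imageSubobject φ
  have ha : a ≤ s := by
    refine Subobject.le_of_comm (biprod.inl ≫ factorThruImageSubobject φ) ?_
    simp [s, φ]
  have hb : b ≤ s := by
    refine Subobject.le_of_comm (biprod.inr ≫ factorThruImageSubobject φ) ?_
    simp [s, φ]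
  have hs : (a ⊔ b) ⊓ c ≤ s := inf_le_left.trans (sup_le ha hb)
  obtain ⟨W, hW⟩ : ∃ W, W = (a ⊔ b) ⊓ c := ⟨_, rfl⟩
  have hWc : W ≤ c := hW ▸ inf_le_right
  rw [← hW] at hs ⊢
  let p := pullback.fst (Subobject.ofLE W s hs) (factorThruImageSubobject φ)
  let q := pullback.snd (Subobject.ofLE W s hs) (factorThruImageSubobject φ)
  have hpq : p ≫ W.arrow = q ≫ φ := by
    have h := pullback.condition (f := Subobject.ofLE W s hs) (g := factorThruImageSubobject φ)
    have h2 := congrArg (fun t => t ≫ s.arrow) h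
    simpa [s, p, q] using h2
  have : Epi p := inferInstanceAs (Epi (pullback.fst _ _))
  have hsum : p ≫ W.arrow = (q ≫ biprod.fst) ≫ a.arrow + (q ≫ biprod.snd) ≫ b.arrow := by
    rw [hpq]; simp [φ, biprod.desc_eq]
  have h1 : c.Factors ((q ≫ biprod.fst) ≫ a.arrow) :=
    Subobject.factors_of_le _ hac (Subobject.factors_comp_arrow _)
  have h2 : c.Factors (p ≫ W.arrow) :=
    Subobject.factors_of_le _ hWc (Subobject.factors_comp_arrow _)
  have h3 : c.Factors ((q ≫ biprod.snd) ≫ b.arrow) :=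
    Subobject.factors_right_of_factors_add _ _ (hsum ▸ h2) h1
  have h4 : (a ⊔ (b ⊓ c)).Factors (p ≫ W.arrow) := by
    rw [hsum]
    refine Subobject.factors_add _ _ ?_ ?_
    · exact Subobject.factors_of_le _ le_sup_left (Subobject.factors_comp_arrow _)
    · refine Subobject.factors_of_le _ le_sup_right ?_
      exact (Subobject.inf_factors _).2 ⟨Subobject.factors_comp_arrow _, h3⟩
  have sq : CommSq (Subobject.factorThru _ _ h4) p (a ⊔ (b ⊓ c)).arrow W.arrow :=
    ⟨by simp⟩
  have : StrongEpi p := strongEpi_of_epi p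
  exact Subobject.le_of_comm sq.lift sq.fac_right

instance modInst (X : C) : IsModularLattice (Subobject X) :=
  ⟨fun {a} b {c} h => mod_aux a b c h⟩

/-- A bounded modular lattice with a finite maximal chain satisfies the descending chain
condition. -/
lemma wf_of_chain {L : Type*} [Lattice L] [BoundedOrder L] [IsModularLattice L]
    (m : ℕ) (f : Fin (m + 1) → L) (h0 : f 0 = ⊥) (h1 : f (Fin.last m) = ⊤)
    (hc : ∀ i : Fin m, f i.castSucc ⋖ f i.succ) : WellFoundedLT L := by
  classical
  let J : L → Finset (Fin m) := fun S =>
    Finset.univ.filter fun i => S ⊓ f i.castSucc ≠ S ⊓ f i.succ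
  have hmono : ∀ S T : L, S ≤ T → J S ⊆ J T := by
    intro S T hST i hi
    simp only [J, Finset.mem_filter, Finset.mem_univ, true_and] at hi ⊢
    intro h
    apply hi
    rw [← inf_eq_left.2 hST, inf_assoc, inf_assoc, h]
  have hstrict : ∀ S T : L, S ≤ T → J S = J T → S = T := by
    intro S T hST hJ
    have key : ∀ i : Fin (m + 1), S ⊓ f i = T ⊓ f i := by
      intro i
      induction i using Fin.induction with
      | zero => simp [h0]
      | succ i ih =>
        by_cases hi : i ∈ J S
        · have hi' := hi
          simp only [J, Finset.mem_filter, Finset.mem_univ, true_and] at hi'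
          have hlt : f i.castSucc < f i.castSucc ⊔ (S ⊓ f i.succ) := by
            refine lt_of_le_of_ne le_sup_left fun h => hi' ?_
            have hle : S ⊓ f i.succ ≤ f i.castSucc := by rw [h]; exact le_sup_right
            exact le_antisymm (inf_le_inf_left _ (hc i).le) (le_inf inf_le_left hle)
          have htop : f i.castSucc ⊔ (S ⊓ f i.succ) = f i.succ := by
            have hle : f i.castSucc ⊔ (S ⊓ f i.succ) ≤ f i.succ :=
              sup_le (hc i).le inf_le_right
            exact hle.eq_of_not_lt fun h => (hc i).2 hlt h
          apply le_antisymm (inf_le_inf_right _ hST)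
          calc T ⊓ f i.succ = ((S ⊓ f i.succ) ⊔ f i.castSucc) ⊓ (T ⊓ f i.succ) := by
                rw [sup_comm, htop]; exact (inf_eq_right.2 inf_le_right).symm
            _ ≤ (S ⊓ f i.succ) ⊔ (f i.castSucc ⊓ (T ⊓ f i.succ)) :=
                IsModularLattice.sup_inf_le_assoc_of_le _ (inf_le_inf_right _ hST)
            _ ≤ S ⊓ f i.succ := by
                refine sup_le le_rfl ?_
                have : f i.castSucc ⊓ (T ⊓ f i.succ) ≤ S ⊓ f i.castSucc := by
                  rw [ih]
                  exact le_inf (inf_le_right.trans inf_le_left) inf_le_left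
                exact this.trans (inf_le_inf_left _ (hc i).le)
        · have hi2 := hJ ▸ hi
          simp only [J, Finset.mem_filter, Finset.mem_univ, true_and, not_not] at hi hi2
          rw [← hi, ← hi2, ih]
    simpa [h1] using key (Fin.last m)
  have hsm : StrictMono fun S : L => (J S).card := by
    intro S T hST
    refine Finset.card_lt_card (lt_of_le_of_ne (hmono S T hST.le) fun h => ?_)
    exact hST.ne (hstrict S T hST.le h)
  exact hsm.wellFoundedLT

lemma exists_indec (hfin : FiniteLength C) (P : C → Prop)
    (hiso : ∀ Y Z : C, (Y ≅ Z) → P Y → P Z) (hzero : ∀ Y : C, IsZero Y → ¬ P Y)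
    (hsum : ∀ Y Z : C, P (Y ⊞ Z) → P Y ∨ P Z) (X : C) (hX : P X) :
    ∃ Q : C, Indecomposable Q ∧ P Q := by
  obtain ⟨m, f, h0, h1, hc⟩ := hfin X
  have : WellFoundedLT (Subobject X) := wf_of_chain m f h0 h1 hc
  obtain ⟨S, hS, hmin⟩ := WellFounded.has_min (wellFounded_lt (α := Subobject X))
    {S | P (S : C)} ⟨⊤, hiso _ _ (asIso (⊤ : Subobject X).arrow).symm hX⟩
  have aux : ∀ (A B : C) (i : A ⟶ (S : C)) [Mono i] (s : B ⟶ (S : C)) (p : (S : C) ⟶ B),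
      i ≫ p = 0 → s ≫ p = 𝟙 B → P A → IsZero B := by
    intro A B i _ s p hip hsp hA
    have hle : Subobject.mk (i ≫ S.arrow) ≤ S := Subobject.mk_le_of_comm i rfl
    have hPA : P (Subobject.mk (i ≫ S.arrow) : C) :=
      hiso _ _ (Subobject.underlyingIso (i ≫ S.arrow)).symm hA
    have heq : Subobject.mk (i ≫ S.arrow) = S := hle.eq_of_not_lt (hmin _ hPA)
    let k := Subobject.ofLEMk S (i ≫ S.arrow) heq.ge
    have hk : k ≫ i = 𝟙 _ := by
      rw [← cancel_mono S.arrow]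
      simp [k]
    rw [IsZero.iff_id_eq_zero, ← hsp, ← Category.id_comp p, ← hk, Category.assoc, hip]
    simp
  refine ⟨(S : C), ⟨fun h => hzero _ h hS, fun A B e => ?_⟩, hS⟩
  rcases hsum A B (hiso _ _ e hS) with h | h
  · right
    exact aux A B (biprod.inl ≫ e.inv) (biprod.inr ≫ e.inv) (e.hom ≫ biprod.snd)
      (by simp) (by simp) h
  · left
    exact aux B A (biprod.inr ≫ e.inv) (biprod.inl ≫ e.inv) (e.hom ≫ biprod.fst)
      (by simp) (by simp) h

variable [HasDerivedCategory.{w} C]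

lemma ext_target (hfin : FiniteLength C) (X Y : C) (d : ℤ) (h : extNonzero C X Y d) :
    ∃ Q : C, Indecomposable Q ∧ extNonzero C X Q d := by
  let G : C ⥤ DerivedCategory C :=
    DerivedCategory.singleFunctor C 0 ⋙ shiftFunctor (DerivedCategory C) d
  have hG : G.Additive := inferInstance
  have hP : ∀ Y : C, extNonzero C X Y d ↔
      ∃ g : (DerivedCategory.singleFunctor C 0).obj X ⟶ G.obj Y, g ≠ 0 := fun _ => Iff.rfl
  refine exists_indec hfin (fun Y => extNonzero C X Y d) ?_ ?_ ?_ Y h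
  · rintro Y Z e h
    obtain ⟨g, hg⟩ := (hP Y).1 h
    refine (hP Z).2 ⟨g ≫ G.map e.hom, fun h0 => hg ?_⟩
    rw [← cancel_mono (G.map e.hom), h0, zero_comp]
  · rintro Y hY h
    obtain ⟨g, hg⟩ := (hP Y).1 h
    exact hg ((G.map_isZero hY).eq_of_tgt _ _)
  · rintro Y Z h
    obtain ⟨g, hg⟩ := (hP _).1 h
    by_contra hcon
    rw [not_or, hP, hP] at hcon
    push Not at hcon
    apply hg
    rw [← Category.comp_id g, ← G.map_id, ← biprod.total, G.map_add, G.map_comp, G.map_comp,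
      Preadditive.comp_add, ← Category.assoc, ← Category.assoc,
      hcon.1 (g ≫ G.map biprod.fst), hcon.2 (g ≫ G.map biprod.snd)]
    simp

lemma ext_source (hfin : FiniteLength C) (X Y : C) (d : ℤ) (h : extNonzero C X Y d) :
    ∃ Q : C, Indecomposable Q ∧ extNonzero C Q Y d := by
  let G : C ⥤ DerivedCategory C := DerivedCategory.singleFunctor C 0
  have hG : G.Additive := inferInstanceAs (DerivedCategory.singleFunctor C 0).Additive
  have hP : ∀ X : C, extNonzero C X Y d ↔
      ∃ g : G.obj X ⟶ (G.obj Y)⟦d⟧, g ≠ 0 := fun _ => Iff.rfl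
  refine exists_indec hfin (fun X => extNonzero C X Y d) ?_ ?_ ?_ X h
  · rintro Y Z e h
    obtain ⟨g, hg⟩ := (hP Y).1 h
    refine (hP Z).2 ⟨G.map e.inv ≫ g, fun h0 => hg ?_⟩
    rw [← cancel_epi (G.map e.inv), h0, comp_zero]
  · rintro Y hY h
    obtain ⟨g, hg⟩ := (hP Y).1 h
    exact hg ((G.map_isZero hY).eq_of_src _ _)
  · rintro Y Z h
    obtain ⟨g, hg⟩ := (hP _).1 h
    by_contra hcon
    rw [not_or, hP, hP] at hcon
    push Not at hcon
    apply hg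
    rw [← Category.id_comp g, ← G.map_id, ← biprod.total, G.map_add, G.map_comp, G.map_comp,
      Preadditive.add_comp, Category.assoc, Category.assoc,
      hcon.1 (G.map biprod.inl ≫ g), hcon.2 (G.map biprod.inr ≫ g)]
    simp

lemma ext_zero {X Y : C} (g : X ⟶ Y) (hg : g ≠ 0) : extNonzero C X Y 0 := by
  refine ⟨(DerivedCategory.singleFunctor C 0).map g ≫
    ((shiftFunctorZero (DerivedCategory C) ℤ).app
      ((DerivedCategory.singleFunctor C 0).obj Y)).inv, fun h => hg ?_⟩
  rw [Preadditive.IsIso.comp_right_eq_zero] at h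
  exact (DerivedCategory.singleFunctor C 0).map_injective (by rw [h, Functor.map_zero])

lemma ext_nonneg {X Y : C} {d : ℤ} (h : extNonzero C X Y d) : 0 ≤ d := by
  by_contra hd
  obtain ⟨g, hg⟩ := h
  apply hg
  have : (DerivedCategory.TStructure.t).IsGE
      (((DerivedCategory.singleFunctor C 0).obj Y)⟦d⟧) (-d) :=
    DerivedCategory.TStructure.t.isGE_shift _ 0 d (-d) (by lia)
  exact DerivedCategory.TStructure.t.zero g 0 (-d) (by lia)

lemma ext_bound (hH : Hereditary C) {X Y : C} {d : ℤ} (h : extNonzero C X Y d) :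
    0 ≤ d ∧ d ≤ 1 := by
  have h0 := ext_nonneg h
  refine ⟨h0, ?_⟩
  by_contra h1
  lift d to ℕ using h0
  exact hH X Y d (by lia) h

lemma ext_of_shift {X Y : C} {a b : ℤ}
    (g : ((DerivedCategory.singleFunctor C 0).obj X)⟦a⟧ ⟶
      ((DerivedCategory.singleFunctor C 0).obj Y)⟦b⟧) (hg : g ≠ 0) :
    extNonzero C X Y (b - a) := by
  let e1 := (shiftFunctorCompIsoId (DerivedCategory C) a (-a) (by lia)).app
    ((DerivedCategory.singleFunctor C 0).obj X)
  let e2 := (shiftFunctorAdd' (DerivedCategory C) b (-a) (b - a) (by lia)).app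
    ((DerivedCategory.singleFunctor C 0).obj Y)
  refine ⟨e1.inv ≫ (shiftFunctor (DerivedCategory C) (-a)).map g ≫ e2.inv, fun h => hg ?_⟩
  rw [Preadditive.IsIso.comp_left_eq_zero, Preadditive.IsIso.comp_right_eq_zero] at h
  exact (shiftFunctor (DerivedCategory C) (-a)).map_injective (by rw [h, Functor.map_zero])

variable {D : Type u'} [Category.{v'} D] [Abelian D] [HasDerivedCategory.{w'} D]

lemma ext_transfer (F : DerivedCategory C ⥤ DerivedCategory D)
    [F.IsEquivalence] [F.CommShift ℤ] {X Y : C} {X' Y' : D} {a b : ℤ}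
    (e : F.obj ((DerivedCategory.singleFunctor C 0).obj X) ≅
        (((DerivedCategory.singleFunctor D 0).obj X')⟦a⟧))
    (e' : F.obj ((DerivedCategory.singleFunctor C 0).obj Y) ≅
        (((DerivedCategory.singleFunctor D 0).obj Y')⟦b⟧))
    {d : ℤ} (h : extNonzero C X Y d) : extNonzero D X' Y' (b + d - a) := by
  obtain ⟨g, hg⟩ := h
  let e2 : F.obj (((DerivedCategory.singleFunctor C 0).obj Y)⟦d⟧) ≅
      (((DerivedCategory.singleFunctor D 0).obj Y')⟦b + d⟧) :=
    (F.commShiftIso d).app _ ≪≫ (shiftFunctor (DerivedCategory D) d).mapIso e' ≪≫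
      ((shiftFunctorAdd' (DerivedCategory D) b d (b + d) rfl).app _).symm
  refine ext_of_shift (e.inv ≫ F.map g ≫ e2.hom) fun h => hg ?_
  rw [Preadditive.IsIso.comp_left_eq_zero, Preadditive.IsIso.comp_right_eq_zero] at h
  apply F.map_injective
  rw [h, Functor.map_zero]

end Helpers

theorem abs_n_sub_n_le_dist_and_gldim_le_diam_add_one
    (hH : Hereditary ℋ)
    (F : DerivedCategory 𝒜 ⥤ DerivedCategory ℋ)
    [F.IsEquivalence] [F.CommShift ℤ] [F.IsTriangulated]
    (f : 𝒜 → ℋ) (n : 𝒜 → ℤ)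
    (hfn : ∀ Q : 𝒜, Indecomposable Q → Indecomposable (f Q) ∧
      Nonempty (F.obj ((DerivedCategory.singleFunctor 𝒜 0).obj Q) ≅
        (((DerivedCategory.singleFunctor ℋ 0).obj (f Q))⟦n Q⟧))) :
    (∀ Q Q' : 𝒜, Indecomposable Q → Indecomposable Q' →
        (((n Q - n Q').natAbs : ℕ∞) ≤ gdist 𝒜 Q Q')) ∧
      (FiniteLength 𝒜 → diam 𝒜 ≠ ⊤ →
        gldim 𝒜 ≤ diam 𝒜 + 1 ∧
          ∀ Q : 𝒜, Indecomposable Q → projDim 𝒜 Q + injDim 𝒜 Q ≤ diam 𝒜 + 2) := by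
  have hbound : ∀ Q Q' : 𝒜, Indecomposable Q → Indecomposable Q' → ∀ d : ℤ,
      extNonzero 𝒜 Q Q' d → 0 ≤ n Q' + d - n Q ∧ n Q' + d - n Q ≤ 1 := by
    intro Q Q' hQ hQ' d h
    obtain ⟨-, ⟨e⟩⟩ := hfn Q hQ
    obtain ⟨-, ⟨e'⟩⟩ := hfn Q' hQ'
    exact ext_bound hH (ext_transfer F e e' h)
  have hdist : ∀ Q Q' : 𝒜, Indecomposable Q → Indecomposable Q' →
      (((n Q - n Q').natAbs : ℕ∞) ≤ gdist 𝒜 Q Q') := by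
    intro Q Q' _ _
    refine le_iInf₂ fun m hm => ?_
    obtain ⟨c, rfl, rfl, hind, hedge⟩ := hm
    have key : ∀ i : Fin (m + 1), (n (c 0) - n (c i)).natAbs ≤ (i : ℕ) := by
      intro i
      induction i using Fin.induction with
      | zero => simp
      | succ i ih =>
        simp only [Fin.val_castSucc] at ih
        simp only [Fin.val_succ]
        rcases hedge i with ⟨g, hg⟩ | ⟨g, hg⟩
        · have := hbound _ _ (hind _) (hind _) 0 (ext_zero g hg)
          lia
        · have := hbound _ _ (hind _) (hind _) 0 (ext_zero g hg)
          lia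
    exact_mod_cast key (Fin.last m)
  refine ⟨hdist, fun hfin hdiam => ?_⟩
  obtain ⟨D, hD⟩ := ENat.ne_top_iff_exists.1 hdiam
  have hn : ∀ Q Q' : 𝒜, Indecomposable Q → Indecomposable Q' → (n Q - n Q').natAbs ≤ D := by
    intro Q Q' hQ hQ'
    have h : gdist 𝒜 Q Q' ≤ diam 𝒜 :=
      le_iSup_of_le Q (le_iSup_of_le Q' (le_iSup_of_le hQ (le_iSup_of_le hQ' le_rfl)))
    have h2 := (hdist Q Q' hQ hQ').trans h
    rw [← hD] at h2
    exact_mod_cast h2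
  rw [← hD]
  constructor
  · refine iSup_le fun X => iSup₂_le fun d hd => ?_
    obtain ⟨Y, hd⟩ := hd
    obtain ⟨Q', hQ', hd⟩ := ext_target hfin _ _ _ hd
    obtain ⟨Q, hQ, hd⟩ := ext_source hfin _ _ _ hd
    have h1 := hbound Q Q' hQ hQ' _ hd
    have h2 := hn Q Q' hQ hQ'
    have : d ≤ D + 1 := by lia
    exact_mod_cast this
  · intro Q hQ
    have hid : extNonzero 𝒜 Q Q ((0 : ℕ) : ℤ) :=
      ext_zero (𝟙 Q) fun h => hQ.1 ((IsZero.iff_id_eq_zero Q).2 h)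
    refine ENat.biSup_add_biSup_le' ⟨0, Q, hid⟩ ⟨0, Q, hid⟩ ?_
    rintro a ⟨Y, ha⟩ b ⟨X, hb⟩
    obtain ⟨Q', hQ', ha⟩ := ext_target hfin _ _ _ ha
    obtain ⟨Q'', hQ'', hb⟩ := ext_source hfin _ _ _ hb
    have h1 := hbound Q Q' hQ hQ' _ ha
    have h2 := hbound Q'' Q hQ'' hQ _ hb
    have h3 := hn Q'' Q' hQ'' hQ'
    have : a + b ≤ D + 2 := by lia
    exact_mod_cast this


end PiecewiseHereditaryPaper
end

section
/- Let 𝒜 be a finite length, piecewise hereditary abelian category which decomposes as a direct sum 𝒜 = ⊕_{i=1}^{m} 𝒜_i of abelian full subcategories. Fix r ≥ 1 and ε ∈ {+1,−1}^r, and assume that for each i there is an indecomposable Q₀^{(i)} of 𝒜_i such that every indecomposable of 𝒜_i is the end of an ε-path in G(𝒜_i) from Q₀^{(i)}. Then gldim 𝒜 ≤ r+1 and projd_𝒜 Q + injd_𝒜 Q ≤ r+2 for every indecomposable Q of 𝒜. -/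
/-!
Statement 10: the conclusion of Theorem 1 holds when the finite length,
piecewise hereditary category `𝒜` is a direct sum `𝒜 = ⊕ᵢ 𝒜ᵢ` of abelian full
subcategories such that each graph `G(𝒜ᵢ)` satisfies the connectivity
condition (for a common `r ≥ 1` and `ε ∈ {+1,−1}^r`).
-/

open CategoryTheory CategoryTheory.Limits

universe w w' v u v' u'

namespace PiecewiseHereditaryPaper

variable (𝒜 : Type u) [Category.{v} 𝒜] [Abelian 𝒜] [HasDerivedCategory.{w} 𝒜]

/-- A triangulated equivalence `D(𝒜) ≃ D(ℋ)`. -/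
structure TriangulatedEquivalence (ℋ : Type u') [Category.{v'} ℋ] [Abelian ℋ]
    [HasDerivedCategory.{w'} ℋ] where
  functor : DerivedCategory 𝒜 ⥤ DerivedCategory ℋ
  isEquivalence : functor.IsEquivalence
  commShift : functor.CommShift ℤ
  isTriangulated : letI := commShift; functor.IsTriangulated

/-- `𝒜` is piecewise hereditary. -/
def IsPiecewiseHereditary : Prop :=
  ∃ (ℋ : Type u') (_ : Category.{v'} ℋ) (_ : Abelian ℋ) (_ : HasDerivedCategory.{w'} ℋ),
    Hereditary ℋ ∧ Nonempty (TriangulatedEquivalence 𝒜 ℋ)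

/-- An `ε`-path from `Q` to `Q'` all of whose vertices lie in the full
subcategory of `𝒜` determined by the predicate `P` (this is an `ε`-path in the
graph `G(𝒜ᵢ)` when `P` cuts out the summand `𝒜ᵢ`). -/
def EpsPathIn (P : 𝒜 → Prop) {r : ℕ} (ε : Fin r → ℤ) (Q Q' : 𝒜) : Prop :=
  ∃ c : Fin (r + 1) → 𝒜,
    c 0 = Q ∧ c (Fin.last r) = Q' ∧ (∀ i, Indecomposable (c i) ∧ P (c i)) ∧
    ∀ i : Fin r,
      (ε i = 1 → ∃ g : c i.castSucc ⟶ c i.succ, g ≠ 0) ∧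
      (ε i = -1 → ∃ g : c i.succ ⟶ c i.castSucc, g ≠ 0)


set_option linter.unusedSectionVars false

section DerivedAux

open DerivedCategory Pretriangulated

variable {C : Type u} [Category.{v} C] [Abelian C] [HasDerivedCategory.{w} C]

lemma epi_of_quasiIso (X : CochainComplex C ℤ) (B : C)
    (s : X ⟶ (HomologicalComplex.single C (ComplexShape.up ℤ) 0).obj B) [QuasiIso s]
    (p : X.X 0 ⟶ B)
    (hφ : ∀ k, (ComplexShape.up ℤ).Rel 0 k → 𝟙 (X.X 0) ≫ X.d 0 k = 0)
    (hp : (HomologicalComplex.single C (ComplexShape.up ℤ) 0).map p =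
      HomologicalComplex.mkHomFromSingle (𝟙 (X.X 0)) hφ ≫ s) : Epi p := by
  let K := (HomologicalComplex.single C (ComplexShape.up ℤ) 0).obj B
  have h1 : IsIso (K.iCycles 0) := K.isIso_iCycles 0 _ rfl (by simp [K])
  have h2 : IsIso (K.homologyπ 0) := K.isIso_homologyπ _ 0 rfl (by simp [K])
  have h3 : Epi (HomologicalComplex.cyclesMap s 0 ≫ K.homologyπ 0) := by
    rw [← HomologicalComplex.homologyπ_naturality]
    infer_instance
  have h4 : Epi (HomologicalComplex.cyclesMap s 0) := by
    have : HomologicalComplex.cyclesMap s 0 =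
      (HomologicalComplex.cyclesMap s 0 ≫ K.homologyπ 0) ≫ inv (K.homologyπ 0) := by simp
    rw [this]
    infer_instance
  have h5 : Epi (X.iCycles 0 ≫ s.f 0) := by
    rw [← HomologicalComplex.cyclesMap_i]
    infer_instance
  have h6 : Epi (s.f 0) := epi_of_epi (X.iCycles 0) (s.f 0)
  have h0 := congrArg (fun φ => HomologicalComplex.Hom.f φ 0) hp
  simp only [HomologicalComplex.comp_f, HomologicalComplex.mkHomFromSingle_f,
    HomologicalComplex.single_map_f_self, Category.comp_id, Iso.cancel_iso_hom_left] at h0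
  have h7 : p = s.f 0 ≫ (HomologicalComplex.singleObjXSelf (ComplexShape.up ℤ) 0 B).hom := by
    rw [← h0]; simp
  rw [h7]
  exact epi_comp _ _

lemma mono_of_quasiIso (X : CochainComplex C ℤ) (B : C)
    (s : (HomologicalComplex.single C (ComplexShape.up ℤ) 0).obj B ⟶ X) [QuasiIso s]
    (p : B ⟶ X.X 0)
    (hφ : ∀ k, (ComplexShape.up ℤ).Rel k 0 → X.d k 0 ≫ 𝟙 (X.X 0) = 0)
    (hp : (HomologicalComplex.single C (ComplexShape.up ℤ) 0).map p =
      s ≫ HomologicalComplex.mkHomToSingle (𝟙 (X.X 0)) hφ) : Mono p := by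
  let K := (HomologicalComplex.single C (ComplexShape.up ℤ) 0).obj B
  have h1 : IsIso (K.pOpcycles 0) := K.isIso_pOpcycles _ 0 rfl (by simp [K])
  have h2 : IsIso (K.homologyι 0) := K.isIso_homologyι 0 _ rfl (by simp [K])
  have h3 : Mono (K.homologyι 0 ≫ HomologicalComplex.opcyclesMap s 0) := by
    rw [← HomologicalComplex.homologyι_naturality]
    infer_instance
  have h4 : Mono (HomologicalComplex.opcyclesMap s 0) := by
    have : HomologicalComplex.opcyclesMap s 0 =
      inv (K.homologyι 0) ≫ (K.homologyι 0 ≫ HomologicalComplex.opcyclesMap s 0) := by simp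
    rw [this]
    infer_instance
  have h5 : Mono (s.f 0 ≫ X.pOpcycles 0) := by
    rw [← HomologicalComplex.p_opcyclesMap]
    infer_instance
  have h6 : Mono (s.f 0) := mono_of_mono (s.f 0) (X.pOpcycles 0)
  have h0 := congrArg (fun φ => HomologicalComplex.Hom.f φ 0) hp
  simp only [HomologicalComplex.comp_f, HomologicalComplex.mkHomToSingle_f,
    HomologicalComplex.single_map_f_self, Category.id_comp] at h0
  have h7 : p = (HomologicalComplex.singleObjXSelf (ComplexShape.up ℤ) 0 B).inv ≫ s.f 0 := by
    rw [← cancel_mono (HomologicalComplex.singleObjXSelf (ComplexShape.up ℤ) 0 (X.X 0)).inv,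
      Category.assoc, ← h0]
    simp
  rw [h7]
  exact mono_comp _ _

/-- A morphism from a single object to a negative object is killed by an epimorphism. -/
lemma exists_epi_kill (B : C) (Z : DerivedCategory C) [hZ : Z.IsLE (-1)]
    (h : (singleFunctor C 0).obj B ⟶ Z) :
    ∃ (E : C) (p : E ⟶ B), Epi p ∧ (singleFunctor C 0).map p ≫ h = 0 := by
  obtain ⟨K, hK, ⟨e⟩⟩ := exists_iso_Q_obj_of_isLE Z (-1)
  let f : Q.obj ((CochainComplex.singleFunctor C 0).obj B) ⟶ Q.obj K := h ≫ e.hom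
  obtain ⟨X, hX, s, hs, g, hg⟩ := right_fac_of_isStrictlyLE f 0
  have hq : QuasiIso s := (isIso_Q_map_iff_quasiIso C s).1 hs
  let j : (CochainComplex.singleFunctor C 0).obj (X.X 0) ⟶ X :=
    HomologicalComplex.mkHomFromSingle (𝟙 (X.X 0)) (by
      intro k hk
      apply IsZero.eq_of_tgt
      simp at hk
      exact X.isZero_of_isStrictlyLE 0 k)
  obtain ⟨p, hp⟩ := (CochainComplex.singleFunctor C 0).map_surjective (j ≫ s)
  refine ⟨X.X 0, p, ?_, ?_⟩
  · exact @epi_of_quasiIso _ _ _ _ X B s hq p _ hp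
  · rw [← cancel_mono e.hom, zero_comp, Category.assoc]
    change Q.map ((CochainComplex.singleFunctor C 0).map p) ≫ f = 0
    rw [hg, hp, Q.map_comp, Category.assoc, IsIso.hom_inv_id_assoc, ← Q.map_comp]
    have : j ≫ g = 0 := by
      apply HomologicalComplex.from_single_hom_ext
      apply IsZero.eq_of_tgt
      exact K.isZero_of_isStrictlyLE (-1) 0
    rw [this, Functor.map_zero]

/-- A morphism to a single object from a positive object is killed by a monomorphism. -/
lemma exists_mono_kill (B : C) (Z : DerivedCategory C) [hZ : Z.IsGE 1]
    (h : Z ⟶ (singleFunctor C 0).obj B) :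
    ∃ (E : C) (p : B ⟶ E), Mono p ∧ h ≫ (singleFunctor C 0).map p = 0 := by
  obtain ⟨K, hK, ⟨e⟩⟩ := exists_iso_Q_obj_of_isGE Z 1
  let f : Q.obj K ⟶ Q.obj ((CochainComplex.singleFunctor C 0).obj B) := e.inv ≫ h
  obtain ⟨X, hX, g, s, hs, hg⟩ := left_fac_of_isStrictlyGE f 0
  have hq : QuasiIso s := (isIso_Q_map_iff_quasiIso C s).1 hs
  let j : X ⟶ (CochainComplex.singleFunctor C 0).obj (X.X 0) :=
    HomologicalComplex.mkHomToSingle (𝟙 (X.X 0)) (by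
      intro k hk
      apply IsZero.eq_of_src
      simp at hk
      exact X.isZero_of_isStrictlyGE 0 k)
  obtain ⟨p, hp⟩ := (CochainComplex.singleFunctor C 0).map_surjective (s ≫ j)
  refine ⟨X.X 0, p, ?_, ?_⟩
  · exact @mono_of_quasiIso _ _ _ _ X B s hq p _ hp
  · rw [← cancel_epi e.inv, comp_zero, ← Category.assoc]
    change f ≫ Q.map ((CochainComplex.singleFunctor C 0).map p) = 0
    rw [hg, hp, Q.map_comp, Category.assoc, IsIso.inv_hom_id_assoc, ← Q.map_comp]
    have : g ≫ j = 0 := by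
      apply HomologicalComplex.to_single_hom_ext
      apply IsZero.eq_of_src
      exact K.isZero_of_isStrictlyGE 1 0
    rw [this, Functor.map_zero]

lemma comp_eq_zero_of_hereditary (hC : Hereditary C) (X Y : C)
    (g : (singleFunctor C 0).obj X ⟶ ((singleFunctor C 0).obj Y)⟦(1 : ℤ)⟧⟦(1 : ℤ)⟧) :
    g = 0 := by
  let e := (shiftFunctorAdd' (DerivedCategory C) (1 : ℤ) 1 2 (by norm_num)).app
    ((singleFunctor C 0).obj Y)
  by_contra hg
  refine hC X Y 2 le_rfl ⟨g ≫ e.inv, fun h => hg ?_⟩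
  rw [← cancel_mono e.inv, h, zero_comp]


lemma left_factor (B : C) (Z : DerivedCategory C) [hZ : Z.IsLE (-1)]
    (h : (singleFunctor C 0).obj B ⟶ Z) :
    ∃ (K : C) (δ : (singleFunctor C 0).obj B ⟶ ((singleFunctor C 0).obj K)⟦(1 : ℤ)⟧)
      (k : ((singleFunctor C 0).obj K)⟦(1 : ℤ)⟧ ⟶ Z), h = δ ≫ k := by
  obtain ⟨E, p, hp, hpg⟩ := exists_epi_kill B _ h
  have S : (ShortComplex.mk (kernel.ι p) p (kernel.condition p)).ShortExact :=
    { exact := ShortComplex.exact_of_f_is_kernel _ (kernelIsKernel p) }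
  obtain ⟨k, hk⟩ := Triangle.yoneda_exact₃ _ S.singleTriangle_distinguished h hpg
  exact ⟨kernel p, S.singleδ, k, hk⟩

lemma right_factor (B : C) (Z : DerivedCategory C) [hZ : Z.IsGE 1]
    (h : Z ⟶ (singleFunctor C 0).obj B) :
    ∃ (K : C) (k : Z⟦(1 : ℤ)⟧ ⟶ (singleFunctor C 0).obj K)
      (δ : (singleFunctor C 0).obj K ⟶ ((singleFunctor C 0).obj B)⟦(1 : ℤ)⟧),
      h⟦(1 : ℤ)⟧' = k ≫ δ := by
  obtain ⟨E, p, hp, hpg⟩ := exists_mono_kill B _ h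
  have S : (ShortComplex.mk p (cokernel.π p) (cokernel.condition p)).ShortExact :=
    { exact := ShortComplex.exact_of_g_is_cokernel _ (cokernelIsCokernel p) }
  obtain ⟨k, hk⟩ := Triangle.coyoneda_exact₁ _ S.singleTriangle_distinguished (h⟦(1 : ℤ)⟧') (by
    change h⟦(1 : ℤ)⟧' ≫ ((singleFunctor C 0).map p)⟦(1 : ℤ)⟧' = 0
    rw [← Functor.map_comp, hpg, Functor.map_zero])
  exact ⟨cokernel p, k, S.singleδ, hk⟩

lemma hom_single_eq_zero (hC : Hereditary C) (M : C) (Z : DerivedCategory C) [hZ : Z.IsLE 0]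
    (g : (singleFunctor C 0).obj M ⟶ Z⟦(1 : ℤ)⟧⟦(1 : ℤ)⟧) : g = 0 := by
  have h1 : (Z⟦(1 : ℤ)⟧).IsLE (-1) := TStructure.t.isLE_shift Z 0 1 (-1)
  have h2 : (Z⟦(1 : ℤ)⟧⟦(1 : ℤ)⟧).IsLE (-2) := TStructure.t.isLE_shift _ (-1) 1 (-2)
  have h2' : (Z⟦(1 : ℤ)⟧⟦(1 : ℤ)⟧).IsLE (-1) := TStructure.t.isLE_of_le _ (-2) (-1)
  obtain ⟨K, δ, h, hh⟩ := left_factor M _ g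
  obtain ⟨h', rfl⟩ := (shiftFunctor (DerivedCategory C) (1 : ℤ)).map_surjective h
  obtain ⟨K', δ', k', hk'⟩ := left_factor _ _ h'
  rw [hh, hk', Functor.map_comp, ← Category.assoc,
    comp_eq_zero_of_hereditary hC _ _ (δ ≫ δ'⟦(1 : ℤ)⟧'), zero_comp]

lemma hom_to_single_eq_zero (hC : Hereditary C) (M : C) (Z : DerivedCategory C) [hZ : Z.IsGE 2]
    (g : Z ⟶ (singleFunctor C 0).obj M) : g = 0 := by
  have h1 : (Z⟦(1 : ℤ)⟧).IsGE 1 := TStructure.t.isGE_shift Z 2 1 1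
  have h2 : Z.IsGE 1 := TStructure.t.isGE_of_ge _ 1 2
  obtain ⟨K, k, δ, hh⟩ := right_factor M _ g
  obtain ⟨K', k', δ', hk'⟩ := right_factor _ _ k
  apply (shiftFunctor (DerivedCategory C) (1 : ℤ)).map_injective
  apply (shiftFunctor (DerivedCategory C) (1 : ℤ)).map_injective
  rw [hh, Functor.map_comp, hk', Functor.map_zero, Functor.map_zero, Category.assoc,
    comp_eq_zero_of_hereditary hC _ _ (δ' ≫ δ⟦(1 : ℤ)⟧'), comp_zero]

end DerivedAux

section RetractAux

open DerivedCategory Pretriangulated ZeroObject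

variable {C : Type u} [Category.{v} C] [Abelian C] [HasDerivedCategory.{w} C]

lemma isIso_homology_mor₂ (T : Triangle (DerivedCategory C)) (hT : T ∈ distTriang _) (n n' : ℤ)
    (h : n + 1 = n') (h₀ : IsZero ((homologyFunctor C n).obj T.obj₁))
    (h₁ : IsZero ((homologyFunctor C n').obj T.obj₁)) :
    IsIso ((homologyFunctor C n).map T.mor₂) := by
  have : Epi ((homologyFunctor C n).map T.mor₂) :=
    (HomologySequence.epi_homologyMap_mor₂_iff T hT n n' h).2 (h₁.eq_of_tgt _ _)
  have : Mono ((homologyFunctor C n).map T.mor₂) :=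
    (HomologySequence.mono_homologyMap_mor₂_iff T hT n).2 (h₀.eq_of_src _ _)
  exact isIso_of_mono_of_epi _

lemma isIso_homology_mor₁ (T : Triangle (DerivedCategory C)) (hT : T ∈ distTriang _) (n n' : ℤ)
    (h : n' + 1 = n) (h₀ : IsZero ((homologyFunctor C n).obj T.obj₃))
    (h₁ : IsZero ((homologyFunctor C n').obj T.obj₃)) :
    IsIso ((homologyFunctor C n).map T.mor₁) := by
  have : Mono ((homologyFunctor C n).map T.mor₁) :=
    (HomologySequence.mono_homologyMap_mor₁_iff T hT n' n h).2 (h₁.eq_of_src _ _)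
  have : Epi ((homologyFunctor C n).map T.mor₁) :=
    (HomologySequence.epi_homologyMap_mor₁_iff T hT n).2 (h₀.eq_of_tgt _ _)
  exact isIso_of_mono_of_epi _

lemma exists_from_single (hC : Hereditary C) (X : DerivedCategory C) :
    ∃ (N : C) (a : (singleFunctor C 0).obj N ⟶ X), IsIso ((homologyFunctor C 0).map a) := by
  obtain ⟨U, B, hU, hB, u, v, w, hT⟩ := TStructure.t.exists_triangle X 0 1 rfl
  obtain ⟨U', M, hU', hM, i, q, d, hT'⟩ := TStructure.t.exists_triangle U (-1) 0 rfl
  have hU : U.IsLE 0 := ⟨hU⟩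
  have hB : B.IsGE 1 := ⟨hB⟩
  have hU' : U'.IsLE (-1) := ⟨hU'⟩
  have hM : M.IsGE 0 := ⟨hM⟩
  have hq : ∀ n : ℤ, 0 ≤ n → IsIso ((homologyFunctor C n).map q) := fun n hn =>
    isIso_homology_mor₂ _ hT' n (n + 1) rfl (isZero_of_isLE U' (-1) n (by lia))
      (isZero_of_isLE U' (-1) (n + 1) (by lia))
  have hM' : M.IsLE 0 := by
    rw [isLE_iff]
    intro n hn
    have := hq n hn.le
    exact (isZero_of_isLE U 0 n hn).of_iso (asIso ((homologyFunctor C n).map q)).symm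
  obtain ⟨N, ⟨e⟩⟩ := exists_iso_singleFunctor_obj_of_isGE_of_isLE M 0
  have hZ : (U'⟦(-1 : ℤ)⟧).IsLE 0 := TStructure.t.isLE_shift U' (-1) (-1) 0
  let φ : U'⟦(-1 : ℤ)⟧⟦(1 : ℤ)⟧ ≅ U' := (shiftEquiv (DerivedCategory C) (1 : ℤ)).counitIso.app U'
  have h0 := hom_single_eq_zero hC N _ (e.inv ≫ d ≫ φ.inv⟦(1 : ℤ)⟧')
  have hd : e.inv ≫ d = 0 := by
    rw [← cancel_mono (φ.inv⟦(1 : ℤ)⟧'), Category.assoc, h0, zero_comp]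
  obtain ⟨σ, hσ⟩ := Triangle.coyoneda_exact₃ _ hT' e.inv hd
  change U ⟶ M at q
  change (singleFunctor C 0).obj N ⟶ U at σ
  change e.inv = σ ≫ q at hσ
  refine ⟨N, σ ≫ u, ?_⟩
  have h1 : IsIso ((homologyFunctor C 0).map u) :=
    isIso_homology_mor₁ _ hT 0 (-1) rfl (isZero_of_isGE B 1 0 (by lia))
      (isZero_of_isGE B 1 (-1) (by lia))
  have h2 := hq 0 le_rfl
  have h3 : IsIso ((homologyFunctor C 0).map σ ≫ (homologyFunctor C 0).map q) := by
    rw [← Functor.map_comp, ← hσ]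
    infer_instance
  have h4 : IsIso ((homologyFunctor C 0).map σ) := IsIso.of_isIso_comp_right _
    ((homologyFunctor C 0).map q)
  rw [Functor.map_comp]
  infer_instance

lemma exists_to_single (hC : Hereditary C) (X : DerivedCategory C) :
    ∃ (N : C) (b : X ⟶ (singleFunctor C 0).obj N), IsIso ((homologyFunctor C 0).map b) := by
  obtain ⟨A, T, hA, hTT, u, x, w, hT⟩ := TStructure.t.exists_triangle X (-1) 0 rfl
  obtain ⟨M, B, hM, hB, i, q, d, hT'⟩ := TStructure.t.exists_triangle T 0 1 rfl
  have hA : A.IsLE (-1) := ⟨hA⟩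
  have hTT : T.IsGE 0 := ⟨hTT⟩
  have hM : M.IsLE 0 := ⟨hM⟩
  have hB : B.IsGE 1 := ⟨hB⟩
  have hq : ∀ n : ℤ, n ≤ 0 → IsIso ((homologyFunctor C n).map i) := fun n hn =>
    isIso_homology_mor₁ _ hT' n (n - 1) (by lia) (isZero_of_isGE B 1 n (by lia))
      (isZero_of_isGE B 1 (n - 1) (by lia))
  have hM' : M.IsGE 0 := by
    rw [isGE_iff]
    intro n hn
    have := hq n hn.le
    exact (isZero_of_isGE T 0 n hn).of_iso (asIso ((homologyFunctor C n).map i))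
  obtain ⟨N, ⟨e⟩⟩ := exists_iso_singleFunctor_obj_of_isGE_of_isLE M 0
  have hZ : (B⟦(-1 : ℤ)⟧).IsGE 2 := TStructure.t.isGE_shift B 1 (-1) 2
  let φ : B⟦(-1 : ℤ)⟧⟦(1 : ℤ)⟧ ≅ B := (shiftEquiv (DerivedCategory C) (1 : ℤ)).counitIso.app B
  obtain ⟨d', hd'⟩ := (shiftFunctor (DerivedCategory C) (1 : ℤ)).map_surjective
    (φ.hom ≫ d ≫ e.hom⟦(1 : ℤ)⟧')
  have h0 := hom_to_single_eq_zero hC N _ d'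
  have hd : d ≫ e.hom⟦(1 : ℤ)⟧' = 0 := by
    rw [← cancel_epi φ.hom, ← hd', h0, Functor.map_zero, comp_zero]
  obtain ⟨ρ', hρ'⟩ := Triangle.yoneda_exact₃ _ (rot_of_distTriang _ hT') (e.hom⟦(1 : ℤ)⟧') hd
  obtain ⟨ρ'', rfl⟩ := (shiftFunctor (DerivedCategory C) (1 : ℤ)).map_surjective ρ'
  change T ⟶ _ at ρ''
  change _ = (-(i⟦(1 : ℤ)⟧')) ≫ ρ''⟦(1 : ℤ)⟧' at hρ'
  have hρ : e.hom = i ≫ (-ρ'') := by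
    apply (shiftFunctor (DerivedCategory C) (1 : ℤ)).map_injective
    refine hρ'.trans ?_
    simp
  generalize -ρ'' = ρ at hρ
  refine ⟨N, x ≫ ρ, ?_⟩
  have h1 : IsIso ((homologyFunctor C 0).map x) :=
    isIso_homology_mor₂ _ hT 0 1 rfl (isZero_of_isLE A (-1) 0 (by lia))
      (isZero_of_isLE A (-1) 1 (by lia))
  have h2 := hq 0 le_rfl
  have h3 : IsIso ((homologyFunctor C 0).map i ≫ (homologyFunctor C 0).map ρ) := by
    rw [← Functor.map_comp, ← hρ]
    infer_instance
  have h4 : IsIso ((homologyFunctor C 0).map ρ) := IsIso.of_isIso_comp_left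
    ((homologyFunctor C 0).map i) _
  rw [Functor.map_comp]
  infer_instance

lemma exists_retract_zero (hC : Hereditary C) (X : DerivedCategory C)
    (hX : ¬ IsZero ((homologyFunctor C 0).obj X)) :
    ∃ (N : C) (ι : (singleFunctor C 0).obj N ⟶ X) (π : X ⟶ (singleFunctor C 0).obj N),
      ¬ IsZero ((singleFunctor C 0).obj N) ∧ ι ≫ π = 𝟙 _ := by
  obtain ⟨N, a, ha⟩ := exists_from_single hC X
  obtain ⟨N', b, hb⟩ := exists_to_single hC X
  have hab : IsIso (a ≫ b) := by
    rw [DerivedCategory.isIso_iff]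
    intro n
    by_cases hn : n = 0
    · subst hn
      rw [Functor.map_comp]
      infer_instance
    · have h : ∀ K : C, IsZero ((homologyFunctor C n).obj ((singleFunctor C 0).obj K)) := by
        intro K
        rcases lt_or_gt_of_ne hn with h | h
        · exact isZero_of_isGE _ 0 n h
        · exact isZero_of_isLE _ 0 n h
      exact (h N).isIso (h N') _
  refine ⟨N, a, b ≫ inv (a ≫ b), fun h => hX ?_, ?_⟩
  · exact ((homologyFunctor C 0).map_isZero h).of_iso (asIso ((homologyFunctor C 0).map a)).symm
  · rw [← Category.assoc, IsIso.hom_inv_id]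

lemma exists_retract (hC : Hereditary C) (X : DerivedCategory C) (hX : ¬ IsZero X) :
    ∃ (n : ℤ) (N : C) (ι : (singleFunctor C 0).obj N ⟶ X⟦n⟧)
      (π : X⟦n⟧ ⟶ (singleFunctor C 0).obj N),
      ¬ IsZero ((singleFunctor C 0).obj N) ∧ ι ≫ π = 𝟙 _ := by
  have : ∃ n : ℤ, ¬ IsZero ((homologyFunctor C n).obj X) := by
    by_contra! h
    apply hX
    have : IsIso (0 : X ⟶ 0) := by
      rw [DerivedCategory.isIso_iff]
      intro n
      exact (h n).isIso ((homologyFunctor C n).map_isZero (isZero_zero _)) _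
    exact (isZero_zero _).of_iso (asIso (0 : X ⟶ 0))
  obtain ⟨n, hn⟩ := this
  refine ⟨n, exists_retract_zero hC (X⟦n⟧) fun h => hn (h.of_iso ?_)⟩
  exact (((homologyFunctor C 0).shiftIso n 0 n (by simp)).app X).symm

end RetractAux

section DegreeAux

open DerivedCategory Pretriangulated

lemma idem_of_indecomposable {A : Type u} [Category.{v} A] [Abelian A] {X : A}
    (hX : Indecomposable X) (e : X ⟶ X) (he : e ≫ e = e) : e = 0 ∨ e = 𝟙 X := by
  obtain ⟨Y, i, p, hip, hpi⟩ := IsIdempotentComplete.idempotents_split X e he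
  obtain ⟨Z, j, q, hjq, hqj⟩ := IsIdempotentComplete.idempotents_split X (𝟙 X - e)
    (by simp [he])
  have hjm : Mono j := mono_of_mono_fac hjq
  have him : Mono i := mono_of_mono_fac hip
  have hiq : i ≫ q = 0 := by
    rw [← cancel_mono j, Category.assoc, hqj, ← hpi]
    simp [reassoc_of% hip]
  have hjp : j ≫ p = 0 := by
    have : e = 𝟙 X - q ≫ j := by rw [hqj]; simp
    rw [← cancel_mono i, Category.assoc, hpi, this]
    simp [reassoc_of% hjq]
  let φ : X ≅ Y ⊞ Z :=
    { hom := biprod.lift p q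
      inv := biprod.desc i j
      hom_inv_id := by simp [hpi, hqj]
      inv_hom_id := by ext <;> simp [hip, hjq, hiq, hjp] }
  rcases hX.2 Y Z φ with h | h
  · left
    rw [← hpi, h.eq_of_tgt p 0, zero_comp]
  · right
    have : 𝟙 X - e = 0 := by rw [← hqj, h.eq_of_tgt q 0, zero_comp]
    rw [sub_eq_zero] at this
    exact this.symm

variable {A : Type u} [Category.{v} A] [Abelian A] [HasDerivedCategory.{w} A]
variable {H : Type u'} [Category.{v'} H] [Abelian H] [HasDerivedCategory.{w'} H]

/-- `F (Q[0])` is, up to the shift by `a`, concentrated in degree zero. -/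
def IsDeg (F : DerivedCategory A ⥤ DerivedCategory H) (Q : A) (a : ℤ) : Prop :=
  ∃ N : H, Nonempty ((F.obj ((singleFunctor A 0).obj Q))⟦a⟧ ≅ (singleFunctor H 0).obj N)

lemma exists_isDeg (hH : Hereditary H) (F : DerivedCategory A ⥤ DerivedCategory H)
    [F.IsEquivalence] [F.CommShift ℤ] [F.IsTriangulated] (Q : A) (hQ : Indecomposable Q) :
    ∃ a : ℤ, IsDeg F Q a := by
  have hX : ¬ IsZero (F.obj ((singleFunctor A 0).obj Q)) := by
    intro h
    apply hQ.1
    rw [IsZero.iff_id_eq_zero]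
    apply (singleFunctor A 0).map_injective
    apply F.map_injective
    exact h.eq_of_src _ _
  obtain ⟨n, N, ι, π, hN, hιπ⟩ := exists_retract hH _ hX
  refine ⟨n, N, ?_⟩
  let G : A ⥤ DerivedCategory H := singleFunctor A 0 ⋙ F ⋙ shiftFunctor (DerivedCategory H) n
  obtain ⟨e, he⟩ := G.map_surjective (X := Q) (Y := Q) (π ≫ ι)
  have hee : e ≫ e = e := by
    apply G.map_injective
    rw [G.map_comp, he]
    simp [reassoc_of% hιπ]
  rcases idem_of_indecomposable hQ e hee with h | h
  · exfalso
    apply hN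
    rw [IsZero.iff_id_eq_zero]
    have h0 : π ≫ ι = 0 := by
      rw [← he, h]
      simp [G]
    calc 𝟙 _ = (ι ≫ π) ≫ (ι ≫ π) := by rw [hιπ, Category.comp_id]
      _ = ι ≫ (π ≫ ι) ≫ π := by simp only [Category.assoc]
      _ = 0 := by rw [h0]; simp
  · exact ⟨⟨π, ι, by rw [← he, h, G.map_id]; rfl, hιπ⟩⟩

lemma nonzero_of_isos {D : Type*} [Category* D] [HasZeroMorphisms D] {X Y X' Y' : D}
    (e : X ≅ X') (f : Y ≅ Y') (h : ∃ g : X ⟶ Y, g ≠ 0) : ∃ g : X' ⟶ Y', g ≠ 0 := by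
  obtain ⟨g, hg⟩ := h
  refine ⟨e.inv ≫ g ≫ f.hom, fun h => hg ?_⟩
  rw [← cancel_epi e.inv, ← cancel_mono f.hom, Category.assoc, h]
  simp

lemma ext_bound_s10 (hH : Hereditary H) (F : DerivedCategory A ⥤ DerivedCategory H)
    [F.IsEquivalence] [F.CommShift ℤ] [F.IsTriangulated] (Q Q' : A) (a b d : ℤ)
    (ha : IsDeg F Q a) (hb : IsDeg F Q' b) (hd : extNonzero A Q Q' d) :
    0 ≤ d + a - b ∧ d + a - b ≤ 1 := by
  obtain ⟨N, ⟨e⟩⟩ := ha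
  obtain ⟨N', ⟨e'⟩⟩ := hb
  obtain ⟨g, hg⟩ := hd
  have h1 : ∃ g : (F.obj ((singleFunctor A 0).obj Q))⟦a⟧ ⟶
      (F.obj (((singleFunctor A 0).obj Q')⟦d⟧))⟦a⟧, g ≠ 0 := by
    refine ⟨(F.map g)⟦a⟧', fun h => hg ?_⟩
    apply F.map_injective
    apply (shiftFunctor (DerivedCategory H) a).map_injective
    rw [h, F.map_zero, Functor.map_zero]
  let f : (F.obj (((singleFunctor A 0).obj Q')⟦d⟧))⟦a⟧ ≅
      ((singleFunctor H 0).obj N')⟦d + a - b⟧ :=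
    (shiftFunctor (DerivedCategory H) a).mapIso ((F.commShiftIso d).app _) ≪≫
      ((shiftFunctorAdd' (DerivedCategory H) d a (d + a) rfl).app _).symm ≪≫
      (shiftFunctorAdd' (DerivedCategory H) b (d + a - b) (d + a) (by lia)).app _ ≪≫
      (shiftFunctor (DerivedCategory H) (d + a - b)).mapIso e'
  obtain ⟨g', hg'⟩ := nonzero_of_isos e f h1
  generalize d + a - b = k at g' hg'
  constructor
  · by_contra! hk
    have : (((singleFunctor H 0).obj N')⟦k⟧).IsGE (-k) := TStructure.t.isGE_shift _ 0 k (-k)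
    exact hg' (TStructure.t.zero g' 0 (-k))
  · by_contra! hk
    obtain ⟨n, rfl⟩ := Int.eq_ofNat_of_zero_le (show 0 ≤ k by lia)
    exact hH N N' n (by lia) ⟨g', hg'⟩

lemma extNonzero_zero_of_hom {Q Q' : A} (g : Q ⟶ Q') (hg : g ≠ 0) : extNonzero A Q Q' 0 := by
  have : ∃ g : (singleFunctor A 0).obj Q ⟶ (singleFunctor A 0).obj Q', g ≠ 0 :=
    ⟨(singleFunctor A 0).map g, fun h => hg (by
      apply (singleFunctor A 0).map_injective
      rw [h, Functor.map_zero])⟩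
  exact nonzero_of_isos (Iso.refl _) ((shiftFunctorZero (DerivedCategory A) ℤ).symm.app _) this

end DegreeAux

lemma path_bound {A : Type u} (deg : A → ℤ) {r : ℕ} (ε : Fin r → ℤ)
    (hε : ∀ i, ε i = 1 ∨ ε i = -1) (c : Fin (r + 1) → A)
    (h1 : ∀ i : Fin r, ε i = 1 →
      0 ≤ deg (c i.castSucc) - deg (c i.succ) ∧ deg (c i.castSucc) - deg (c i.succ) ≤ 1)
    (h2 : ∀ i : Fin r, ε i = -1 →
      0 ≤ deg (c i.succ) - deg (c i.castSucc) ∧ deg (c i.succ) - deg (c i.castSucc) ≤ 1) :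
    (∑ i, if ε i = 1 then (0 : ℤ) else -1) ≤ deg (c 0) - deg (c (Fin.last r)) ∧
      deg (c 0) - deg (c (Fin.last r)) ≤ (∑ i, if ε i = 1 then (0 : ℤ) else -1) + r := by
  induction r with
  | zero => simp
  | succ r ih =>
    have := ih (fun i => ε i.castSucc) (fun i => hε _) (fun i => c i.castSucc)
      (fun i hi => h1 i.castSucc hi) (fun i hi => h2 i.castSucc hi)
    rw [Fin.sum_univ_castSucc]
    have a1 := h1 (Fin.last r)
    have a2 := h2 (Fin.last r)
    have a3 := hε (Fin.last r)
    simp only [Fin.castSucc_zero, Fin.succ_last] at this a1 a2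
    generalize (∑ i : Fin r, if ε i.castSucc = 1 then (0 : ℤ) else -1) = S at *
    rcases a3 with h | h
    · have := a1 h
      rw [if_pos h]
      push_cast
      lia
    · have := a2 h
      rw [if_neg (by rw [h]; decide)]
      push_cast
      lia

section ComponentAux

open DerivedCategory Pretriangulated

attribute [local instance] Abelian.hasFiniteBiproducts

variable {A : Type u} [Category.{v} A] [Abelian A]

lemma exists_central (m : ℕ) (P : Fin m → A → Prop)
    (hsum : ∀ X : A, ∃ (s : ℕ) (g : Fin s → A), (∀ j, ∃ i, P i (g j)) ∧ Nonempty (X ≅ ⨁ g))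
    (hzero : ∀ (i j : Fin m), i ≠ j → ∀ (X Y : A), P i X → P j Y → ∀ g : X ⟶ Y, g = 0)
    (i : Fin m) :
    ∃ τ : ∀ X : A, X ⟶ X, (∀ (X Y : A) (f : X ⟶ Y), τ X ≫ f = f ≫ τ Y) ∧
      (∀ X, P i X → τ X = 𝟙 X) ∧ (∀ k X, k ≠ i → P k X → τ X = 0) := by
  choose s g hg φ using hsum
  replace φ := fun X => Classical.choice (φ X)
  choose comp hcomp using hg
  let μ : ∀ X, (⨁ g X) ⟶ (⨁ g X) := fun X =>
    biproduct.map (fun j => if comp X j = i then 𝟙 (g X j) else 0)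
  refine ⟨fun X => (φ X).hom ≫ μ X ≫ (φ X).inv, ?_, ?_, ?_⟩
  · intro X Y f
    have key : ∀ f' : (⨁ g X) ⟶ (⨁ g Y), μ X ≫ f' = f' ≫ μ Y := by
      intro f'
      apply biproduct.hom_ext
      intro l
      apply biproduct.hom_ext'
      intro j
      by_cases hjl : comp X j = comp Y l
      · simp only [μ, Category.assoc, biproduct.map_π, biproduct.ι_map_assoc, hjl]
        split_ifs <;> simp
      · have h0 := hzero _ _ hjl _ _ (hcomp X j) (hcomp Y l)
        rw [h0 (_ ≫ (μ X ≫ f') ≫ _), h0 (_ ≫ (f' ≫ μ Y) ≫ _)]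
    have := key ((φ X).inv ≫ f ≫ (φ Y).hom)
    simp only [Category.assoc]
    rw [← cancel_epi (φ X).inv, ← cancel_mono (φ Y).hom]
    simpa using this
  · intro X hX
    have : μ X ≫ (φ X).inv = (φ X).inv := by
      apply biproduct.hom_ext'
      intro j
      by_cases hj : comp X j = i
      · simp [μ, hj]
      · have h0 := hzero _ _ hj _ _ (hcomp X j) hX
        exact (h0 _).trans (h0 _).symm
    simp [this]
  · intro k X hk hX
    have : μ X ≫ (φ X).inv = 0 := by
      apply biproduct.hom_ext'
      intro j
      by_cases hj : comp X j = i
      · exact (hzero _ _ (fun h => hk (by rw [← h, hj])) _ _ (hcomp X j) hX _).trans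
          (by simp)
      · simp [μ, hj]
    simp [this]

/-- The action of a central element on a cochain complex. -/
def centralMap (τ : ∀ X : A, X ⟶ X) (hτ : ∀ (X Y : A) (f : X ⟶ Y), τ X ≫ f = f ≫ τ Y)
    (K : CochainComplex A ℤ) : K ⟶ K where
  f n := τ (K.X n)
  comm' _ _ _ := hτ _ _ _

lemma central_single_one (τ : ∀ X : A, X ⟶ X)
    (hτ : ∀ (X Y : A) (f : X ⟶ Y), τ X ≫ f = f ≫ τ Y) (X : A) (hX : τ X = 𝟙 X) (n : ℤ) :
    τ (((HomologicalComplex.single A (ComplexShape.up ℤ) 0).obj X).X n) = 𝟙 _ := by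
  by_cases hn : n = 0
  · subst hn
    let e := HomologicalComplex.singleObjXSelf (ComplexShape.up ℤ) 0 X
    rw [← cancel_mono e.hom, hτ, hX, Category.comp_id, Category.id_comp]
  · exact (HomologicalComplex.isZero_single_obj_X _ 0 X n hn).eq_of_src _ _

lemma central_single_zero (τ : ∀ X : A, X ⟶ X)
    (hτ : ∀ (X Y : A) (f : X ⟶ Y), τ X ≫ f = f ≫ τ Y) (X : A) (hX : τ X = 0) (n : ℤ) :
    τ (((HomologicalComplex.single A (ComplexShape.up ℤ) 0).obj X).X n) = 0 := by
  by_cases hn : n = 0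
  · subst hn
    let e := HomologicalComplex.singleObjXSelf (ComplexShape.up ℤ) 0 X
    rw [← cancel_mono e.hom, hτ, hX, comp_zero, zero_comp]
  · exact (HomologicalComplex.isZero_single_obj_X _ 0 X n hn).eq_of_src _ _

variable [HasDerivedCategory.{w} A]

lemma central_naturality (τ : ∀ X : A, X ⟶ X)
    (hτ : ∀ (X Y : A) (f : X ⟶ Y), τ X ≫ f = f ≫ τ Y) (K L : CochainComplex A ℤ)
    (g : Q.obj K ⟶ Q.obj L) :
    Q.map (centralMap τ hτ K) ≫ g = g ≫ Q.map (centralMap τ hτ L) := by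
  have nat : ∀ {K L : CochainComplex A ℤ} (f : K ⟶ L),
      centralMap τ hτ K ≫ f = f ≫ centralMap τ hτ L := by
    intro K L f
    ext n
    exact hτ _ _ _
  obtain ⟨X, s, hs, f, rfl⟩ := right_fac g
  rw [← cancel_epi (Q.map s)]
  rw [← Q.map_comp_assoc, ← nat]
  simp only [Functor.map_comp, Category.assoc, IsIso.hom_inv_id_assoc]
  rw [← Q.map_comp, nat, Q.map_comp]

lemma ext_zero_of_components (m : ℕ) (P : Fin m → A → Prop)
    (hsum : ∀ X : A, ∃ (s : ℕ) (g : Fin s → A), (∀ j, ∃ i, P i (g j)) ∧ Nonempty (X ≅ ⨁ g))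
    (hzero : ∀ (i j : Fin m), i ≠ j → ∀ (X Y : A), P i X → P j Y → ∀ g : X ⟶ Y, g = 0)
    (i k : Fin m) (hik : k ≠ i) (X Y : A) (hX : P i X) (hY : P k Y) (d : ℤ) :
    ¬ extNonzero A X Y d := by
  obtain ⟨τ, hτ, h1, h0⟩ := exists_central m P hsum hzero i
  rintro hg
  let K := (HomologicalComplex.single A (ComplexShape.up ℤ) 0).obj X
  let L : CochainComplex A ℤ := (HomologicalComplex.single A (ComplexShape.up ℤ) 0).obj Y
  let e : ((singleFunctor A 0).obj Y)⟦d⟧ ≅ Q.obj (L⟦d⟧) := ((Q.commShiftIso d).app L).symm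
  let e₀ : (singleFunctor A 0).obj X ≅ Q.obj K := Iso.refl _
  obtain ⟨g, hg⟩ := nonzero_of_isos e₀ e hg
  apply hg
  have h := central_naturality τ hτ K (L⟦d⟧) g
  have hK : centralMap τ hτ K = 𝟙 K := by
    refine HomologicalComplex.hom_ext _ _ fun n => ?_
    exact central_single_one τ hτ X (h1 X hX) n
  have hL : centralMap τ hτ (L⟦d⟧) = 0 := by
    refine HomologicalComplex.hom_ext _ _ fun n => ?_
    exact central_single_zero τ hτ Y (h0 k Y hik hY) (n + d)
  rw [hK, hL] at h
  simpa using h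

end ComponentAux

section LengthAux

variable {A : Type u} [Category.{v} A] [Abelian A]

/-- `LenLE n X` expresses that `X` has length at most `n`. -/
def LenLE : ℕ → A → Prop
  | 0, X => IsZero X
  | n + 1, X => ∃ (S : A) (p : X ⟶ S),
      (∀ (Y : A) (g : Y ⟶ X), Mono g → g ≫ p = 0 ∨ Epi (g ≫ p)) ∧ LenLE n (kernel p)

/-- The comparison map between kernels. -/
noncomputable abbrev kerComp {X Y S : A} (i : Y ⟶ X) (p : X ⟶ S) : kernel (i ≫ p) ⟶ kernel p :=
  kernel.lift p (kernel.ι (i ≫ p) ≫ i) (by rw [Category.assoc, kernel.condition])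

lemma mono_kerComp {X Y S : A} (i : Y ⟶ X) [Mono i] (p : X ⟶ S) : Mono (kerComp i p) := by
  have : Mono (kerComp i p ≫ kernel.ι p) := by
    rw [kernel.lift_ι]
    infer_instance
  exact mono_of_mono _ (kernel.ι p)

lemma LenLE.of_mono {n : ℕ} {X Y : A} (i : Y ⟶ X) [Mono i] (h : LenLE n X) : LenLE n Y := by
  induction n generalizing X Y with
  | zero =>
    change IsZero X at h
    exact IsZero.of_mono i h
  | succ n ih =>
    obtain ⟨S, p, hp, hk⟩ := h
    have := mono_kerComp i p
    refine ⟨S, i ≫ p, fun Z g hg => ?_, ih (kerComp i p) hk⟩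
    have := hp Z (g ≫ i) inferInstance
    rwa [Category.assoc] at this

lemma isIso_of_kerComp {X Y S : A} (i : Y ⟶ X) [Mono i] (p : X ⟶ S) [Epi (i ≫ p)]
    [IsIso (kerComp i p)] : IsIso i := by
  have hp : Epi p := epi_of_epi i p
  have : Epi i := by
    apply Preadditive.epi_of_cancel_zero
    intro T q hq
    have h1 : kernel.ι p ≫ q = 0 := by
      rw [← cancel_epi (kerComp i p), kernel.lift_ι_assoc, Category.assoc, hq]
      simp
    have h2 : p ≫ Abelian.epiDesc p q h1 = q := Abelian.comp_epiDesc p q h1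
    have h3 : Abelian.epiDesc p q h1 = 0 := by
      rw [← cancel_epi (i ≫ p), Category.assoc, h2, hq, comp_zero]
    rw [← h2, h3, comp_zero]
  exact isIso_of_mono_of_epi i

lemma LenLE.strict {n : ℕ} {X Y : A} (i : Y ⟶ X) [Mono i] (hi : ¬ IsIso i)
    (h : LenLE (n + 1) X) : LenLE n Y := by
  induction n generalizing X Y with
  | zero =>
    obtain ⟨S, p, hp, hk⟩ := h
    rcases hp Y i inferInstance with h0 | h0
    · have : Mono (kernel.lift p i h0) := by
        have : Mono (kernel.lift p i h0 ≫ kernel.ι p) := by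
          rw [kernel.lift_ι]
          infer_instance
        exact mono_of_mono _ (kernel.ι p)
      exact hk.of_mono (kernel.lift p i h0)
    · exfalso
      apply hi
      have := mono_kerComp i p
      change IsZero (kernel p) at hk
      have h2 : IsZero (kernel (i ≫ p)) := IsZero.of_mono (kerComp i p) hk
      have : IsIso (kerComp i p) := h2.isIso hk _
      exact isIso_of_kerComp i p
  | succ n ih =>
    obtain ⟨S, p, hp, hk⟩ := h
    have hm := mono_kerComp i p
    rcases hp Y i inferInstance with h0 | h0
    · have : Mono (kernel.lift p i h0) := by
        have : Mono (kernel.lift p i h0 ≫ kernel.ι p) := by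
          rw [kernel.lift_ι]
          infer_instance
        exact mono_of_mono _ (kernel.ι p)
      exact hk.of_mono (kernel.lift p i h0)
    · have h1 : ¬ IsIso (kerComp i p) := fun h => hi (isIso_of_kerComp i p)
      refine ⟨S, i ≫ p, fun Z g hg => ?_, ih (kerComp i p) h1 hk⟩
      have := hp Z (g ≫ i) inferInstance
      rwa [Category.assoc] at this

lemma LenLE.of_covBy {n : ℕ} {X : A} {U V : Subobject X} (hUV : U ⋖ V)
    (h : LenLE n (U : A)) : LenLE (n + 1) (V : A) := by
  let j : (U : A) ⟶ (V : A) := Subobject.ofLE U V hUV.le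
  refine ⟨_, cokernel.π j, ?_, ?_⟩
  · intro Y g hg
    let W : Subobject X := Subobject.mk (g ≫ V.arrow)
    have hWV : W ≤ V := Subobject.mk_le_of_comm g rfl
    rcases hUV.eq_or_eq (c := U ⊔ W) le_sup_left (sup_le hUV.le hWV) with h1 | h1
    · left
      have hWU : W ≤ U := h1 ▸ le_sup_right
      let t : Y ⟶ (U : A) := Subobject.ofMkLE (g ≫ V.arrow) U hWU
      have ht : g = t ≫ j := by
        rw [← cancel_mono V.arrow, Category.assoc, Subobject.ofLE_arrow, Subobject.ofMkLE_arrow]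
      rw [ht, Category.assoc, cokernel.condition, comp_zero]
    · right
      apply Preadditive.epi_of_cancel_zero
      intro T t ht
      let q := cokernel.π j ≫ t
      have hq1 : g ≫ q = 0 := by rw [← ht, Category.assoc]
      have hq2 : j ≫ q = 0 := by simp [q]
      let K : Subobject X := Subobject.mk (kernel.ι q ≫ V.arrow)
      have hU : U ≤ K := Subobject.le_mk_of_comm (kernel.lift q j hq2) (by simp [j])
      have hW : W ≤ K := Subobject.mk_le_mk_of_comm (kernel.lift q g hq1) (by simp)
      have hV : V ≤ K := h1 ▸ sup_le hU hW
      let s : (V : A) ⟶ kernel q := Subobject.ofLEMk V (kernel.ι q ≫ V.arrow) hV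
      have hs : s ≫ kernel.ι q = 𝟙 _ := by
        rw [← cancel_mono V.arrow, Category.assoc, Subobject.ofLEMk_comp, Category.id_comp]
      have hq : q = 0 := by
        rw [← Category.id_comp q, ← hs, Category.assoc, kernel.condition, comp_zero]
      rw [← cancel_epi (cokernel.π j), comp_zero]
      exact hq
  · have hm : Mono j := inferInstance
    let t := Abelian.monoLift j (kernel.ι (cokernel.π j)) (kernel.condition _)
    have ht : t ≫ j = kernel.ι (cokernel.π j) := Abelian.monoLift_comp _ _ _
    have : Mono t := mono_of_mono_fac ht
    exact h.of_mono t

lemma exists_lenLE (hfl : FiniteLength A) (X : A) : ∃ n, LenLE n X := by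
  obtain ⟨m, f, h0, h1, hf⟩ := hfl X
  refine ⟨m, ?_⟩
  have key : ∀ i : Fin (m + 1), LenLE i.val (f i : A) := by
    intro i
    induction i using Fin.induction with
    | zero =>
      rw [h0]
      change IsZero _
      exact (isZero_zero A).of_iso Subobject.botCoeIsoZero
    | succ i ih => exact ih.of_covBy (hf i)
  have h := key (Fin.last m)
  rw [h1] at h
  exact h.of_mono (inv (⊤ : Subobject X).arrow)

lemma exists_indecomposable (hfl : FiniteLength A) (Φ : A → Prop)
    (hΦ : ∀ X, Φ X → ¬ IsZero X)
    (hΦ' : ∀ X Y Z, (X ≅ Y ⊞ Z) → Φ X → Φ Y ∨ Φ Z) (X : A) (hX : Φ X) :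
    ∃ Q, Indecomposable Q ∧ Φ Q := by
  obtain ⟨n, hn⟩ := exists_lenLE hfl X
  induction n generalizing X with
  | zero => exact (hΦ X hX hn).elim
  | succ n ih =>
    by_cases hI : Indecomposable X
    · exact ⟨X, hI, hX⟩
    have : ∃ (Y Z : A) (_ : X ≅ Y ⊞ Z), ¬ IsZero Y ∧ ¬ IsZero Z := by
      by_contra! h
      refine hI ⟨hΦ X hX, fun Y Z e => ?_⟩
      by_contra! h'
      exact h'.2 (h Y Z e h'.1)
    obtain ⟨Y, Z, e, hY, hZ⟩ := this
    rcases hΦ' X Y Z e hX with h | h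
    · refine ih Y h (hn.strict (biprod.inl ≫ e.inv) fun hiso => hZ ?_)
      have h1 : IsIso (biprod.inl : Y ⟶ Y ⊞ Z) := IsIso.of_isIso_comp_right _ e.inv
      have h2 : (biprod.snd : Y ⊞ Z ⟶ Z) = 0 := by
        rw [← cancel_epi (biprod.inl : Y ⟶ Y ⊞ Z)]
        simp
      rw [IsZero.iff_id_eq_zero, ← biprod.inr_snd (X := Y), h2, comp_zero]
    · refine ih Z h (hn.strict (biprod.inr ≫ e.inv) fun hiso => hY ?_)
      have h1 : IsIso (biprod.inr : Z ⟶ Y ⊞ Z) := IsIso.of_isIso_comp_right _ e.inv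
      have h2 : (biprod.fst : Y ⊞ Z ⟶ Y) = 0 := by
        rw [← cancel_epi (biprod.inr : Z ⟶ Y ⊞ Z)]
        simp
      rw [IsZero.iff_id_eq_zero, ← biprod.inl_fst (Y := Z), h2, comp_zero]

variable [HasDerivedCategory.{w} A]

open DerivedCategory

lemma single_id_split {X Y Z : A} (e : X ≅ Y ⊞ Z) :
    𝟙 ((singleFunctor A 0).obj X) =
      (singleFunctor A 0).map (e.hom ≫ biprod.fst) ≫ (singleFunctor A 0).map (biprod.inl ≫ e.inv) +
      (singleFunctor A 0).map (e.hom ≫ biprod.snd) ≫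
        (singleFunctor A 0).map (biprod.inr ≫ e.inv) := by
  rw [← Functor.map_comp, ← Functor.map_comp, ← Functor.map_add, ← CategoryTheory.Functor.map_id]
  congr 1
  rw [← cancel_mono e.hom, ← cancel_epi e.inv]
  simp [Preadditive.add_comp, Preadditive.comp_add]

lemma extNonzero_split_left {X Y Z W : A} {d : ℤ} (e : X ≅ Y ⊞ Z) (h : extNonzero A X W d) :
    extNonzero A Y W d ∨ extNonzero A Z W d := by
  obtain ⟨g, hg⟩ := h
  by_contra! hh
  simp only [extNonzero, not_exists, not_not] at hh
  apply hg
  rw [← Category.id_comp g, single_id_split e, Preadditive.add_comp, Category.assoc,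
    Category.assoc, hh.1 (_ ≫ g), hh.2 (_ ≫ g)]
  simp

lemma extNonzero_split_right {X Y Z W : A} {d : ℤ} (e : X ≅ Y ⊞ Z) (h : extNonzero A W X d) :
    extNonzero A W Y d ∨ extNonzero A W Z d := by
  obtain ⟨g, hg⟩ := h
  by_contra! hh
  simp only [extNonzero, not_exists, not_not] at hh
  apply hg
  rw [← Category.comp_id g, ← CategoryTheory.Functor.map_id, single_id_split e, Functor.map_add,
    (shiftFunctor (DerivedCategory A) d).map_comp, (shiftFunctor (DerivedCategory A) d).map_comp,
    Preadditive.comp_add, ← Category.assoc, ← Category.assoc, hh.1 (g ≫ _), hh.2 (g ≫ _)]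
  simp

lemma extNonzero_not_isZero_left {X W : A} {d : ℤ} (h : extNonzero A X W d) : ¬ IsZero X := by
  obtain ⟨g, hg⟩ := h
  exact fun h => hg (((singleFunctor A 0).map_isZero h).eq_of_src _ _)

lemma extNonzero_not_isZero_right {X W : A} {d : ℤ} (h : extNonzero A W X d) : ¬ IsZero X := by
  obtain ⟨g, hg⟩ := h
  exact fun h => hg (((shiftFunctor _ d).map_isZero
    ((singleFunctor A 0).map_isZero h)).eq_of_tgt _ _)

end LengthAux


section FinalAux

attribute [local instance] Abelian.hasFiniteBiproducts

lemma indecomposable_component {A : Type u} [Category.{v} A] [Abelian A]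
    (m : ℕ) (P : Fin m → A → Prop) (hiso : ∀ i (X Y : A), (X ≅ Y) → P i X → P i Y)
    (hsum : ∀ X : A, ∃ (s : ℕ) (g : Fin s → A), (∀ j, ∃ i, P i (g j)) ∧ Nonempty (X ≅ ⨁ g))
    (Q : A) (hQ : Indecomposable Q) : ∃ i, P i Q := by
  obtain ⟨s, g, hg, ⟨φ⟩⟩ := hsum Q
  let e : Fin s → (Q ⟶ Q) := fun j => (φ.hom ≫ biproduct.π g j) ≫ (biproduct.ι g j ≫ φ.inv)
  have hιπ : ∀ j, (biproduct.ι g j ≫ φ.inv) ≫ (φ.hom ≫ biproduct.π g j) = 𝟙 _ := by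
    intro j
    simp
  have hidem : ∀ j, e j ≫ e j = e j := by
    intro j
    simp [e]
  have htot : ∑ j, e j = 𝟙 Q := by
    have h := biproduct.total (f := g)
    have h2 : 𝟙 Q = φ.hom ≫ (∑ j, biproduct.π g j ≫ biproduct.ι g j) ≫ φ.inv := by
      rw [h]
      simp
    rw [h2, Preadditive.sum_comp, Preadditive.comp_sum]
    simp [e]
  have hex : ∃ j, e j = 𝟙 Q := by
    by_contra! h
    apply hQ.1
    rw [IsZero.iff_id_eq_zero, ← htot]
    apply Finset.sum_eq_zero
    intro j _
    exact (idem_of_indecomposable hQ (e j) (hidem j)).resolve_right (h j)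
  obtain ⟨j, hj⟩ := hex
  obtain ⟨i, hi⟩ := hg j
  exact ⟨i, hiso i _ _ ⟨biproduct.ι g j ≫ φ.inv, φ.hom ≫ biproduct.π g j, hιπ j, hj⟩ hi⟩

end FinalAux

lemma exists_degree (A : Type u) [Category.{v} A] [Abelian A] [HasDerivedCategory.{w} A]
    (hph : IsPiecewiseHereditary.{w, w', v, u, v', u'} A) :
    ∃ deg : A → ℤ, ∀ (Q Q' : A) (d : ℤ), Indecomposable Q → Indecomposable Q' →
      extNonzero A Q Q' d → 0 ≤ d + deg Q - deg Q' ∧ d + deg Q - deg Q' ≤ 1 := by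
  obtain ⟨H, _, _, _, hH, ⟨E⟩⟩ := hph
  have := E.isEquivalence
  letI := E.commShift
  have := E.isTriangulated
  have h : ∀ Q : A, ∃ a : ℤ, Indecomposable Q → IsDeg E.functor Q a := by
    intro Q
    by_cases hQ : Indecomposable Q
    · obtain ⟨a, ha⟩ := exists_isDeg hH E.functor Q hQ
      exact ⟨a, fun _ => ha⟩
    · exact ⟨0, fun h => (hQ h).elim⟩
  choose deg hdeg using h
  exact ⟨deg, fun Q Q' d hQ hQ' hd =>
    ext_bound_s10 hH E.functor Q Q' _ _ d (hdeg Q hQ) (hdeg Q' hQ') hd⟩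


theorem gldim_le_of_direct_sum_decomposition
    (hfl : FiniteLength 𝒜) (hph : IsPiecewiseHereditary.{w, w', v, u, v', u'} 𝒜)
    (m : ℕ) (P : Fin m → 𝒜 → Prop)
    -- each `𝒜ᵢ` is a full subcategory, closed under isomorphisms
    (hiso : ∀ i (X Y : 𝒜), (X ≅ Y) → P i X → P i Y)
    -- every object of `𝒜` is a finite direct sum of objects of the `𝒜ᵢ`
    (hsum : ∀ X : 𝒜, ∃ (s : ℕ) (g : Fin s → 𝒜),
      (∀ j, ∃ i, P i (g j)) ∧
      letI : HasFiniteBiproducts 𝒜 := Abelian.hasFiniteBiproducts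
      letI : HasBiproductsOfShape (Fin s) 𝒜 := HasFiniteBiproducts.out s
      Nonempty (X ≅ ⨁ g))
    -- there are no nonzero morphisms between objects of different summands
    (hzero : ∀ (i j : Fin m), i ≠ j → ∀ (X Y : 𝒜), P i X → P j Y →
      ∀ g : X ⟶ Y, g = 0)
    (r : ℕ) (hr : 1 ≤ r) (ε : Fin r → ℤ) (hε : ∀ i, ε i = 1 ∨ ε i = -1)
    -- connectivity of each `G(𝒜ᵢ)`
    (hconn : ∀ i : Fin m, ∃ Q₀ : 𝒜, Indecomposable Q₀ ∧ P i Q₀ ∧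
      ∀ Q : 𝒜, Indecomposable Q → P i Q → EpsPathIn 𝒜 (P i) ε Q₀ Q) :
    gldim 𝒜 ≤ (r : ℕ∞) + 1 ∧
      ∀ Q : 𝒜, Indecomposable Q → projDim 𝒜 Q + injDim 𝒜 Q ≤ (r : ℕ∞) + 2 := by
  obtain ⟨deg, hdeg⟩ := exists_degree 𝒜 hph
  have hhom : ∀ (Q Q' : 𝒜), Indecomposable Q → Indecomposable Q' → (∃ g : Q ⟶ Q', g ≠ 0) →
      0 ≤ deg Q - deg Q' ∧ deg Q - deg Q' ≤ 1 := by
    rintro Q Q' hQ hQ' ⟨g, hg⟩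
    have := hdeg Q Q' 0 hQ hQ' (extNonzero_zero_of_hom g hg)
    lia
  -- degrees in a component differ by at most `r`
  have hcomp : ∀ (i : Fin m) (Q Q' : 𝒜), Indecomposable Q → Indecomposable Q' → P i Q → P i Q' →
      deg Q - deg Q' ≤ r := by
    intro i Q Q' hQ hQ' hPQ hPQ'
    obtain ⟨Q₀, hQ₀, hPQ₀, hpath⟩ := hconn i
    have key : ∀ Q : 𝒜, Indecomposable Q → P i Q →
        (∑ i, if ε i = 1 then (0 : ℤ) else -1) ≤ deg Q₀ - deg Q ∧
        deg Q₀ - deg Q ≤ (∑ i, if ε i = 1 then (0 : ℤ) else -1) + r := by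
      intro Q hQ hPQ
      obtain ⟨c, hc0, hcr, hc, hcε⟩ := hpath Q hQ hPQ
      have := path_bound deg ε hε c
        (fun i hi => hhom _ _ (hc _).1 (hc _).1 ((hcε i).1 hi))
        (fun i hi => hhom _ _ (hc _).1 (hc _).1 ((hcε i).2 hi))
      rwa [hc0, hcr] at this
    have h1 := key Q hQ hPQ
    have h2 := key Q' hQ' hPQ'
    lia
  -- the components of the endpoints of a nonzero extension agree
  have hsame : ∀ (Q Q' : 𝒜) (d : ℤ) (i : Fin m), P i Q → Indecomposable Q' →
      extNonzero 𝒜 Q Q' d → P i Q' := by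
    intro Q Q' d i hi hQ' hd
    obtain ⟨k, hk⟩ := indecomposable_component m P hiso hsum Q' hQ'
    by_cases hik : k = i
    · exact hik ▸ hk
    · exact (ext_zero_of_components m P hsum hzero i k hik Q Q' hi hk d hd).elim
  have hright : ∀ (X Y : 𝒜) (d : ℤ), extNonzero 𝒜 X Y d →
      ∃ Q', Indecomposable Q' ∧ extNonzero 𝒜 X Q' d := fun X Y d h =>
    exists_indecomposable hfl (fun Y => extNonzero 𝒜 X Y d)
      (fun _ h => extNonzero_not_isZero_right h) (fun _ _ _ e h => extNonzero_split_right e h) Y h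
  have hleft : ∀ (X Y : 𝒜) (d : ℤ), extNonzero 𝒜 X Y d →
      ∃ Q', Indecomposable Q' ∧ extNonzero 𝒜 Q' Y d := fun X Y d h =>
    exists_indecomposable hfl (fun X => extNonzero 𝒜 X Y d)
      (fun _ h => extNonzero_not_isZero_left h) (fun _ _ _ e h => extNonzero_split_left e h) X h
  constructor
  · refine iSup_le fun X => iSup₂_le fun d hd => ?_
    obtain ⟨Y, hd⟩ := hd
    obtain ⟨Q, hQ, hd⟩ := hleft X Y d hd
    obtain ⟨Q', hQ', hd⟩ := hright Q Y d hd
    obtain ⟨i, hi⟩ := indecomposable_component m P hiso hsum Q hQ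
    have h1 := hcomp i Q' Q hQ' hQ (hsame Q Q' d i hi hQ' hd) hi
    have h2 := hdeg Q Q' d hQ hQ' hd
    have h3 : d ≤ r + 1 := by lia
    exact_mod_cast h3
  · intro Q hQ
    obtain ⟨i, hi⟩ := indecomposable_component m P hiso hsum Q hQ
    have h0 : extNonzero 𝒜 Q Q ((0 : ℕ) : ℤ) :=
      extNonzero_zero_of_hom (𝟙 Q) (fun h => hQ.1 ((IsZero.iff_id_eq_zero Q).2 h))
    refine ENat.biSup_add_biSup_le' ⟨0, Q, h0⟩ ⟨0, Q, h0⟩ ?_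
    rintro d ⟨Y, hd⟩ d' ⟨Y', hd'⟩
    obtain ⟨Q₁, hQ₁, hd⟩ := hright Q Y d hd
    obtain ⟨Q₂, hQ₂, hd'⟩ := hleft Y' Q d' hd'
    have hP₁ := hsame Q Q₁ d i hi hQ₁ hd
    obtain ⟨k, hk⟩ := indecomposable_component m P hiso hsum Q₂ hQ₂
    have hki : P k Q := hsame Q₂ Q d' k hk hQ hd'
    have hP₂ : P i Q₂ := by
      by_cases h : k = i
      · exact h ▸ hk
      · exact (hQ.1 ((IsZero.iff_id_eq_zero Q).2 (hzero k i h Q Q hki hi (𝟙 Q)))).elim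
    have h1 := hcomp i Q₁ Q₂ hQ₁ hQ₂ hP₁ hP₂
    have h2 := hdeg Q Q₁ d hQ hQ₁ hd
    have h3 := hdeg Q₂ Q d' hQ₂ hQ hd'
    have h4 : d + d' ≤ r + 2 := by lia
    exact_mod_cast h4

end PiecewiseHereditaryPaper
end
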